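/- Assume GCH. Suppose A ⊆ S³₁ = {γ < ω₃ : cf γ = ω₁} is stationary with a square sequence, and suppose there exist regressive functions f_i (i < ω₄) on {α < ω₃ : cf α ≤ ω₁} such that {α : f_i(α) = f_j(α)} is nonstationary for i ≠ j. Then there exist stationary sets S_i ⊆ {α < ω₃ : cf α = ω} (i < ω₄) such that the sets Tr(S_i) ∩ A (i < ω₄) are stationary and pairwise almost disjoint (any two intersect in a nonstationary set). -/

import Mathlib

/-- `C` is a closed unbounded (club) subset of the ordinal `γ`:
it is a set of ordinals below `γ`, unbounded in `γ`, and closed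
(contains each of its limit points below `γ`). -/
def IsClubIn (C : Set Ordinal) (γ : Ordinal) : Prop :=
  C ⊆ Set.Iio γ ∧ (∀ β < γ, ∃ α ∈ C, β ≤ α) ∧
    ∀ α < γ, 0 < α → (∀ β < α, ∃ c ∈ C, β < c ∧ c < α) → α ∈ C

/-- `S` is stationary in the ordinal `γ`: it meets every club subset of `γ`. -/
def IsStatIn (S : Set Ordinal) (γ : Ordinal) : Prop :=
  ∀ C, IsClubIn C γ → (S ∩ C).Nonempty

/-- The order type of a set of ordinals. -/
noncomputable def otp (s : Set Ordinal) : Ordinal :=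
  Ordinal.type ((· < ·) : s → s → Prop)

/-- The trace of `S` below `ω₃`: `{γ < ω₃ : S ∩ γ is stationary in γ}`. -/
def Tr3 (S : Set Ordinal) : Set Ordinal :=
  {γ | γ < (Cardinal.aleph 3).ord ∧ IsStatIn (S ∩ Set.Iio γ) γ}

namespace SQ
open Cardinal Ordinal Set

universe u v w

def Lim (a : Ordinal.{u}) : Prop := 0 < a ∧ ∀ b < a, b + 1 < a

theorem Lim.isSuccLimit {a : Ordinal.{u}} (h : Lim a) : Order.IsSuccLimit a := by
  rw [Ordinal.isSuccLimit_iff]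
  refine ⟨h.1.ne', ?_⟩
  rw [Order.isSuccPrelimit_iff_succ_lt]
  intro b hb
  rw [Order.succ_eq_add_one]
  exact h.2 b hb

theorem lim_of_aleph0_le {κ : Ordinal.{u}} (hκ : ℵ₀ ≤ κ.cof) : Lim κ := by
  have h := Ordinal.one_lt_cof_iff.1 (Cardinal.one_lt_aleph0.trans_le hκ)
  refine ⟨pos_iff_ne_zero.2 (Ordinal.isSuccLimit_iff.1 h).1, fun b hb => ?_⟩
  rw [← Order.succ_eq_add_one]
  exact h.succ_lt hb

/-- closing off -/
theorem close {κ : Ordinal.{u}} (hκ : ℵ₀ < κ.cof) (R : Ordinal.{u} → Ordinal.{u} → Prop)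
    (h : ∀ a < κ, ∃ a' < κ, a < a' ∧ R a a') {b : Ordinal.{u}} (hb : b < κ) :
    ∃ a < κ, b < a ∧ Lim a ∧ ∀ c < a, ∃ x y, c ≤ x ∧ x < y ∧ y < a ∧ R x y := by
  choose! s hs1 hs2 hs3 using h
  let q : ℕ → Ordinal.{u} := fun n => s^[n] b
  have hq : ∀ n, q n < κ := by
    intro n
    induction n with
    | zero => exact hb
    | succ n ih =>
      simp only [q, Function.iterate_succ_apply']
      exact hs1 _ ih
  have hqs : ∀ n, q (n+1) = s (q n) := fun n => by
    simp only [q, Function.iterate_succ_apply']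
  have hlt : ∀ n, q n < q (n+1) := fun n => by rw [hqs]; exact hs2 _ (hq n)
  have hle : ∀ n, q n ≤ ⨆ n, q n := fun n => Ordinal.le_iSup q n
  have hltS : ∀ n, q n < ⨆ n, q n := fun n => (hlt n).trans_le (hle _)
  have key : ∀ c < ⨆ n, q n, ∃ n, c < q n := fun c hc => Ordinal.lt_iSup_iff.1 hc
  refine ⟨⨆ n, q n, ?_, hltS 0, ⟨(zero_le).trans_lt (hltS 0), ?_⟩, ?_⟩
  · apply Ordinal.lift_iSup_lt_of_lt_cof _ hq
    simpa using hκ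
  · intro c hc
    obtain ⟨n, hn⟩ := key c hc
    refine lt_of_le_of_lt ?_ (hltS n)
    rw [← Order.succ_eq_add_one]
    exact Order.succ_le_of_lt hn
  · intro c hc
    obtain ⟨n, hn⟩ := key c hc
    refine ⟨q n, q (n+1), hn.le, hlt n, hltS _, ?_⟩
    rw [hqs]
    exact hs3 _ (hq n)

theorem club_gt {D : Set Ordinal.{u}} {κ : Ordinal.{u}} (hκ : Lim κ) (hD : IsClubIn D κ)
    {b : Ordinal.{u}} (hb : b < κ) : ∃ d ∈ D, b < d ∧ d < κ := by
  obtain ⟨d, hd, hbd⟩ := hD.2.1 (b+1) (hκ.2 b hb)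
  exact ⟨d, hd, lt_of_lt_of_le (by simp) hbd, hD.1 hd⟩

/-- limit points of a club -/
theorem club_lim {D : Set Ordinal.{u}} {κ : Ordinal.{u}} (hκ : ℵ₀ < κ.cof) (hD : IsClubIn D κ) :
    IsClubIn {a | a < κ ∧ Lim a ∧ ∀ b < a, ∃ d ∈ D, b < d ∧ d < a} κ := by
  have hl := lim_of_aleph0_le hκ.le
  refine ⟨fun a ha => ha.1, ?_, ?_⟩
  · intro b hb
    obtain ⟨a, ha, hba, hla, hc⟩ := close hκ (fun x y => ∃ d ∈ D, x < d ∧ d < y) (by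
      intro a ha
      obtain ⟨d, hd, had, hdκ⟩ := club_gt hl hD ha
      exact ⟨d + 1, hl.2 _ hdκ, had.trans (by simp), d, hd, had, by simp⟩) hb
    refine ⟨a, ⟨ha, hla, ?_⟩, hba.le⟩
    intro c hca
    obtain ⟨x, y, hcx, _, hya, d, hd, hxd, hdy⟩ := hc c hca
    exact ⟨d, hd, hcx.trans_lt hxd, hdy.trans hya⟩
  · intro a ha h0 h
    refine ⟨ha, ⟨h0, ?_⟩, ?_⟩
    · intro b hb
      obtain ⟨c, hc, hbc, hca⟩ := h b hb
      refine lt_of_le_of_lt ?_ hca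
      rw [← Order.succ_eq_add_one]
      exact Order.succ_le_of_lt hbc
    · intro b hb
      obtain ⟨c, hc, hbc, hca⟩ := h b hb
      obtain ⟨d, hd, hbd, hdc⟩ := hc.2.2 b hbc
      exact ⟨d, hd, hbd, hdc.trans hca⟩

/-- diagonal intersection -/
theorem club_diag {c : Cardinal.{u}} (hc : c.IsRegular) (hc0 : ℵ₀ < c)
    (B : Ordinal.{u} → Type (u+1)) (hB : ∀ d < c.ord, #(B d) < Cardinal.lift.{u+1} c)
    (D : ∀ d, B d → Set Ordinal.{u}) (hD : ∀ d < c.ord, ∀ x, IsClubIn (D d x) c.ord) :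
    IsClubIn {a | a < c.ord ∧ Lim a ∧ ∀ d < a, ∀ x, a ∈ D d x} c.ord := by
  have hκ : ℵ₀ < c.ord.cof := by rw [hc.cof_ord]; exact hc0
  have hl := lim_of_aleph0_le hκ.le
  refine ⟨fun a ha => ha.1, ?_, ?_⟩
  · intro b hb
    obtain ⟨a, ha, hba, hla, hcl⟩ := close hκ
      (fun x y => ∀ d ≤ x, ∀ z, ∃ e ∈ D d z, x < e ∧ e < y) (by
      intro a ha
      have : ∀ p : (Σ d : Iio (a+1), B d.1), ∃ e ∈ D p.1.1 p.2, a < e ∧ e < c.ord := by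
        rintro ⟨⟨d, hd⟩, x⟩
        have hd' : d < c.ord := lt_of_lt_of_le hd (hl.2 _ ha).le
        exact club_gt hl (hD d hd' x) ha
      choose e he1 he2 he3 using this
      have hcard : #(Σ d : Iio (a+1), B d.1) < Cardinal.lift.{u+1} c := by
        rw [Cardinal.mk_sigma]
        apply Cardinal.sum_lt_of_isRegular hc.lift
        · rw [Cardinal.mk_Iio_ordinal, Cardinal.lift_lt]
          exact Cardinal.lt_ord.1 (hl.2 _ ha)
        · rintro ⟨d, hd⟩
          exact hB d (lt_of_lt_of_le hd (hl.2 _ ha).le)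
      have hsup := Ordinal.lift_iSup_add_one_lt_of_lt_cof (f := e) (a := c.ord) (by
        rw [← Ordinal.lift_cof, hc.cof_ord]
        rw [Cardinal.lift_id'.{u,u+1}]
        exact hcard) he3
      have : Small.{u} (Σ d : Iio (a+1), B d.1) := by
        rw [Cardinal.small_iff_lift_mk_lt_univ]
        have h1 := Cardinal.lift_lt_univ c
        have h2 := hcard.trans h1
        simpa using h2
      refine ⟨max (⨆ p, (e p + 1)) (a+1), max_lt hsup (hl.2 _ ha), by simp, ?_⟩
      intro d hd z
      have hda : d < a + 1 := lt_of_le_of_lt hd (by simp)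
      refine ⟨e ⟨⟨d, hda⟩, z⟩, he1 ⟨⟨d, hda⟩, z⟩, he2 _, ?_⟩
      · refine lt_max_of_lt_left ?_
        refine lt_of_lt_of_le (b := e ⟨⟨d, hda⟩, z⟩ + 1) (by simp) ?_
        exact Ordinal.le_iSup (fun p => e p + 1) _) hb
    refine ⟨a, ⟨ha, hla, ?_⟩, hba.le⟩
    intro d hd x
    refine (hD d (hd.trans ha) x).2.2 a ha hla.1 ?_
    intro b' hb'
    obtain ⟨x', y, hcx, _, hya, h⟩ := hcl (max b' d) (max_lt hb' hd)
    obtain ⟨e, he, hxe, hey⟩ := h d ((le_max_right _ _).trans hcx) x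
    exact ⟨e, he, ((le_max_left _ _).trans hcx).trans_lt hxe, hey.trans hya⟩
  · intro a ha h0 h
    refine ⟨ha, ⟨h0, ?_⟩, ?_⟩
    · intro b hb
      obtain ⟨c, hc, hbc, hca⟩ := h b hb
      refine lt_of_le_of_lt ?_ hca
      rw [← Order.succ_eq_add_one]
      exact Order.succ_le_of_lt hbc
    · intro d hd x
      refine (hD d (hd.trans ha) x).2.2 a ha h0 ?_
      intro b hb
      obtain ⟨e, he, hbe, hea⟩ := h (max b d) (max_lt hb hd)
      exact ⟨e, he.2.2 d ((le_max_right _ _).trans_lt hbe) x, (le_max_left _ _).trans_lt hbe, hea⟩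

structure Enu (A : Set Ordinal.{u}) (e : Ordinal.{u} → Ordinal.{u} → Ordinal.{u}) : Prop where
  lt : ∀ g ∈ A, ∀ n < (aleph 1).ord, e g n < g
  mono : ∀ g ∈ A, ∀ n < (aleph 1).ord, ∀ m < n, e g m < e g n
  cofinal : ∀ g ∈ A, ∀ b < g, ∃ n < (aleph 1).ord, b < e g n
  cont : ∀ g ∈ A, ∀ n < (aleph 1).ord, Lim n → ∀ b < e g n, ∃ m < n, b < e g m
  coh : ∀ g ∈ A, ∀ g' ∈ A, ∀ n < (aleph 1).ord, ∀ n' < (aleph 1).ord, e g n = e g' n' →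
    n = n' ∧ ∀ m ≤ n, e g m = e g' m
  club : ∀ g ∈ A, IsClubIn (e g '' Iio (aleph 1).ord) g

theorem type_Iio' (o : Ordinal.{u}) :
    Ordinal.type ((· < ·) : Iio o → Iio o → Prop) = Ordinal.lift.{u+1} o := by
  simp

theorem w1_cof : ((aleph 1).ord : Ordinal.{u}).cof = aleph 1 :=
  Cardinal.isRegular_aleph_one.cof_ord

theorem w1_lim : Lim ((aleph 1).ord : Ordinal.{u}) :=
  lim_of_aleph0_le (by rw [w1_cof]; exact Cardinal.aleph0_le_aleph 1)

theorem exists_enu {A : Set Ordinal.{u}} (hcof : ∀ g ∈ A, g.cof = aleph 1)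
    (C : Ordinal → Set Ordinal)
    (hclub : ∀ γ ∈ A, IsClubIn (C γ) γ)
    (hotp : ∀ γ ∈ A, otp (C γ) = (Cardinal.aleph 1).ord)
    (hcoh : ∀ γ₁ ∈ A, ∀ γ₂ ∈ A, ∀ α, α ∈ C γ₁ ∩ C γ₂ →
      C γ₁ ∩ Set.Iio α = C γ₂ ∩ Set.Iio α) : ∃ e, Enu A e := by
  have h1 : ∀ g ∈ A, ∃ e : Ordinal.{u} → Ordinal.{u},
      (∀ n < (aleph 1).ord, ∀ m < n, e m < e n) ∧ e '' Iio (aleph 1).ord = C g := by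
    intro g hg
    have h := hotp g hg
    have h2 : Ordinal.type ((· < ·) : Iio ((aleph 1).ord : Ordinal.{u}) → _ → Prop)
      = Ordinal.type ((· < ·) : C g → C g → Prop) := by
      rw [type_Iio', Cardinal.lift_ord, Cardinal.lift_aleph]
      rw [otp] at h
      rw [h]
      simp
    obtain ⟨r⟩ := Ordinal.type_eq.1 h2
    refine ⟨fun n => if h : n < (aleph 1).ord then (r ⟨n, h⟩).1 else 0, ?_, ?_⟩
    · intro n hn m hm
      have hm' := hm.trans hn
      simp only [hn, hm', dite_true]
      have : r ⟨m, hm'⟩ < r ⟨n, hn⟩ := r.map_rel_iff.2 (by exact hm)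
      exact this
    · ext x
      constructor
      · rintro ⟨n, hn, rfl⟩
        have hn' : n < (aleph 1).ord := hn
        simp only [hn', dite_true]
        exact (r ⟨n, hn⟩).2
      · intro hx
        refine ⟨(r.symm ⟨x, hx⟩).1, (r.symm ⟨x, hx⟩).2, ?_⟩
        have hn' : (r.symm ⟨x, hx⟩).1 < (aleph 1).ord := (r.symm ⟨x, hx⟩).2
        exact (dif_pos hn').trans (congrArg Subtype.val (r.apply_symm_apply ⟨x, hx⟩))
  choose! e hmono hrange using h1
  have hmem : ∀ g ∈ A, ∀ n < (aleph 1).ord, e g n ∈ C g := by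
    intro g hg n hn
    rw [← hrange g hg]
    exact ⟨n, hn, rfl⟩
  have hlt : ∀ g ∈ A, ∀ n < (aleph 1).ord, e g n < g :=
    fun g hg n hn => (hclub g hg).1 (hmem g hg n hn)
  have hlim : ∀ g ∈ A, Lim g := fun g hg => lim_of_aleph0_le (by
    rw [hcof g hg]; exact Cardinal.aleph0_le_aleph 1)
  have hinj : ∀ g ∈ A, ∀ n < (aleph 1).ord, ∀ m < (aleph 1).ord, e g n < e g m → n < m := by
    intro g hg n hn m hm h
    by_contra hc
    rcases (not_lt.1 hc).lt_or_eq with h' | h'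
    · exact lt_asymm h (hmono g hg n hn m h')
    · rw [h'] at h; exact lt_irrefl _ h
  have agree : ∀ g ∈ A, ∀ g' ∈ A, ∀ n < (aleph 1).ord, ∀ n' < (aleph 1).ord,
      e g n = e g' n' → ∀ m, m < n → m < n' → e g m = e g' m := by
    intro g hg g' hg' n hn n' hn' hnn m
    have hC := hcoh g hg g' hg' (e g n) ⟨hmem g hg n hn, by rw [hnn]; exact hmem g' hg' n' hn'⟩
    induction m using WellFoundedLT.induction with
    | ind m ih =>
      intro hmn hmn'
      have hm1 := hmn.trans hn
      apply le_antisymm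
      · have : e g' m ∈ C g ∩ Iio (e g n) := by
          rw [hC]; exact ⟨hmem g' hg' m hm1, by rw [hnn]; exact hmono g' hg' n' hn' m hmn'⟩
        rw [← hrange g hg] at this
        obtain ⟨⟨k, hk, hke⟩, _⟩ := this
        by_contra hc
        rw [not_le, ← hke] at hc
        have hkm := hinj g hg k hk m hm1 hc
        have := ih k hkm (hkm.trans hmn) (hkm.trans hmn')
        have h3 := hmono g' hg' m hm1 k hkm
        rw [← this, hke] at h3
        exact lt_irrefl _ h3
      · have : e g m ∈ C g' ∩ Iio (e g n) := by
          rw [← hC]; exact ⟨hmem g hg m hm1, hmono g hg n hn m hmn⟩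
        rw [← hrange g' hg'] at this
        obtain ⟨⟨k, hk, hke⟩, _⟩ := this
        by_contra hc
        rw [not_le, ← hke] at hc
        have hkm := hinj g' hg' k hk m hm1 hc
        have := ih k hkm (hkm.trans hmn) (hkm.trans hmn')
        have h3 := hmono g hg m hm1 k hkm
        rw [this, hke] at h3
        exact lt_irrefl _ h3
  have notlt : ∀ g ∈ A, ∀ g' ∈ A, ∀ n < (aleph 1).ord, ∀ n' < (aleph 1).ord,
      e g n = e g' n' → ¬ n < n' := by
    intro g hg g' hg' n hn n' hn' hnn hlt'
    have hC := hcoh g hg g' hg' (e g n) ⟨hmem g hg n hn, by rw [hnn]; exact hmem g' hg' n' hn'⟩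
    have : e g' n ∈ C g ∩ Iio (e g n) := by
      rw [hC]; exact ⟨hmem g' hg' n hn, by rw [hnn]; exact hmono g' hg' n' hn' n hlt'⟩
    rw [← hrange g hg] at this
    obtain ⟨⟨k, hk, hke⟩, hk2⟩ := this
    rw [← hke] at hk2
    have hkn := hinj g hg k hk n hn hk2
    have h3 := agree g hg g' hg' n hn n' hn' hnn k hkn (hkn.trans hlt')
    have h4 := hmono g' hg' n hn k hkn
    rw [← h3, hke] at h4
    exact lt_irrefl _ h4
  refine ⟨e, hlt, hmono, ?_, ?_, ?_, ?_⟩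
  · intro g hg b hb
    obtain ⟨d, hd, hbd, _⟩ := club_gt (hlim g hg) (hclub g hg) hb
    rw [← hrange g hg] at hd
    obtain ⟨n, hn, rfl⟩ := hd
    exact ⟨n, hn, hbd⟩
  · intro g hg n hn hln b hb
    by_contra hc
    push Not at hc
    -- least upper bound
    let U : Set Ordinal.{u} := {x | ∀ m < n, e g m ≤ x}
    have hU : U.Nonempty := ⟨b, hc⟩
    let x := sInf U
    have hxU : x ∈ U := csInf_mem hU
    have hxb : x ≤ b := csInf_le' hc
    have hex : ∀ m < n, e g m < x := fun m hm =>
      (hmono g hg (m+1) ((hln.2 m hm).trans hn) m (by simp)).trans_le (hxU _ (hln.2 m hm))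
    have hxC : x ∈ C g := by
      refine (hclub g hg).2.2 x (hxb.trans_lt (hb.trans (hlt g hg n hn))) ?_ ?_
      · exact lt_of_le_of_lt zero_le (hex 0 hln.1)
      · intro y hy
        have : y ∉ U := fun h => not_lt.2 (csInf_le' h) hy
        simp only [U, mem_ofPred_eq, not_forall, not_le] at this
        obtain ⟨m, hm, hym⟩ := this
        exact ⟨e g m, hmem g hg m (hm.trans hn), hym, hex m hm⟩
    rw [← hrange g hg] at hxC
    obtain ⟨k, hk, hkx⟩ := hxC
    have hkn : k < n := hinj g hg k hk n hn (by rw [hkx]; exact hxb.trans_lt hb)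
    exact lt_irrefl _ (hkx ▸ hex k hkn)
  · intro g hg g' hg' n hn n' hn' hnn
    have heq : n = n' := le_antisymm (not_lt.1 (notlt g' hg' g hg n' hn' n hn hnn.symm))
      (not_lt.1 (notlt g hg g' hg' n hn n' hn' hnn))
    refine ⟨heq, fun m hm => ?_⟩
    subst heq
    rcases hm.lt_or_eq with h | h
    · exact agree g hg g' hg' n hn n hn hnn m h h
    · rw [h]; exact hnn
  · intro g hg
    rw [hrange g hg]
    exact hclub g hg

theorem w1_cof' : ℵ₀ < ((aleph 1).ord : Ordinal.{u}).cof := by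
  rw [w1_cof]; exact Cardinal.aleph0_lt_aleph_one

theorem Enu.cof {A : Set Ordinal.{u}} {e} (E : Enu A e) {g} (hg : g ∈ A) {n : Ordinal.{u}}
    (hn : n < (aleph 1).ord) (hl : Lim n) : (e g n).cof = ℵ₀ := by
  have h1 : n.cof = ℵ₀ := Ordinal.cof_eq_aleph0_of_isSuccLimit hl.isSuccLimit (by
    rw [← Cardinal.ord_aleph]; exact hn)
  let f : Iio n → Iio (e g n) := fun m => ⟨e g m.1, E.mono g hg n hn m.1 m.2⟩
  have h2 := Order.cof_congr_of_strictMono (f := f) (by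
    rintro ⟨a, ha⟩ ⟨b, hb⟩ hab
    exact E.mono g hg b (lt_trans hb hn) a hab) (by
    rintro ⟨b, hb⟩
    obtain ⟨m, hm, hbm⟩ := E.cont g hg n hn hl b hb
    exact ⟨f ⟨m, hm⟩, ⟨_, rfl⟩, hbm.le⟩)
  rw [Ordinal.cof_Iio, Ordinal.cof_Iio, ← Ordinal.lift_cof, ← Ordinal.lift_cof,
    Cardinal.lift_inj] at h2
  rw [← h2, h1]

/-- pull back of a club -/
theorem Enu.pull {A : Set Ordinal.{u}} {e} (E : Enu A e) {g} (hg : g ∈ A) (hgl : Lim g)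
    {D : Set Ordinal.{u}} (hD : IsClubIn D g) :
    IsClubIn {n | n < (aleph 1).ord ∧ Lim n ∧ e g n ∈ D} (aleph 1).ord := by
  refine ⟨fun n hn => hn.1, ?_, ?_⟩
  · intro b hb
    obtain ⟨a, ha, hba, hla, hc⟩ := close w1_cof' (fun x y => ∃ d ∈ D, e g x < d ∧ d < e g y) (by
      intro a ha
      obtain ⟨d, hd, had, hdg⟩ := club_gt hgl hD (E.lt g hg a ha)
      obtain ⟨n, hn, hdn⟩ := E.cofinal g hg d hdg
      refine ⟨n, hn, ?_, d, hd, had, hdn⟩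
      by_contra hcon
      rcases (not_lt.1 hcon).lt_or_eq with h | h
      · exact lt_asymm (had.trans hdn) (E.mono g hg a ha n h)
      · rw [h] at hdn; exact lt_asymm had hdn) hb
    refine ⟨a, ⟨ha, hla, ?_⟩, hba.le⟩
    refine hD.2.2 _ (E.lt g hg a ha) (lt_of_le_of_lt zero_le (E.mono g hg a ha 0 hla.1)) ?_
    intro y hy
    obtain ⟨m, hm, hym⟩ := E.cont g hg a ha hla y hy
    obtain ⟨x, z, hmx, _, hza, d, hd, hxd, hdz⟩ := hc m hm
    refine ⟨d, hd, ?_, hdz.trans (E.mono g hg a ha z hza)⟩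
    rcases hmx.lt_or_eq with h | h
    · exact (hym.trans (E.mono g hg x (by order) m h)).trans hxd
    · rw [h] at hym; exact hym.trans hxd
  · intro a ha h0 h
    have hla : Lim a := by
      refine ⟨h0, ?_⟩
      intro b hb
      obtain ⟨c, hc, hbc, hca⟩ := h b hb
      refine lt_of_le_of_lt ?_ hca
      rw [← Order.succ_eq_add_one]
      exact Order.succ_le_of_lt hbc
    refine ⟨ha, hla, ?_⟩
    refine hD.2.2 _ (E.lt g hg a ha) (lt_of_le_of_lt zero_le (E.mono g hg a ha 0 h0)) ?_
    intro y hy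
    obtain ⟨m, hm, hym⟩ := E.cont g hg a ha hla y hy
    obtain ⟨c, hc, hmc, hca⟩ := h m hm
    exact ⟨e g c, hc.2.2, hym.trans (E.mono g hg c hc.1 m hmc), E.mono g hg a ha c hca⟩

/-- pressing down at `ω₁` -/
theorem Enu.fodor {A : Set Ordinal.{u}} {e} (E : Enu A e) {g} (hg : g ∈ A)
    (F : Ordinal.{u} → Ordinal.{u}) (hF : ∀ a < g, a.cof = ℵ₀ → F a < a) :
    ∃ d < g, IsStatIn {n | F (e g n) < d} (aleph 1).ord := by
  by_contra hcon
  push Not at hcon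
  have h1 : ∀ m < (aleph 1).ord, ∃ D, IsClubIn D (aleph 1).ord ∧ ∀ n ∈ D, ¬ F (e g n) < e g m := by
    intro m hm
    have := hcon (e g m) (E.lt g hg m hm)
    simp only [IsStatIn, not_forall] at this
    obtain ⟨D, hD, hne⟩ := this
    exact ⟨D, hD, fun n hn hlt => hne ⟨n, hlt, hn⟩⟩
  choose! D hD1 hD2 using h1
  have hd := club_diag Cardinal.isRegular_aleph_one Cardinal.aleph0_lt_aleph_one
    (fun _ => PUnit) (by
      intro d _
      rw [Cardinal.mk_punit, Cardinal.lift_aleph]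
      exact Cardinal.one_lt_aleph0.trans_le (Cardinal.aleph0_le_aleph _)) (fun d _ => D d) (fun d hd _ => hD1 d hd)
  obtain ⟨n, ⟨hn, hl, hn2⟩, _⟩ := hd.2.1 0 w1_lim.1
  have h3 := hF (e g n) (E.lt g hg n hn) (E.cof hg hn hl)
  obtain ⟨m, hm, hlt⟩ := E.cont g hg n hn hl _ h3
  exact hD2 m (hm.trans hn) n (hn2 m hm PUnit.unit) hlt

theorem reg3 : (aleph 3 : Cardinal.{u}).IsRegular := by
  have := Cardinal.isRegular_aleph_add_one.{u} 2
  rwa [show (2 + 1 : Ordinal.{u}) = 3 by norm_num] at this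

theorem reg4 : (aleph 4 : Cardinal.{u}).IsRegular := by
  have := Cardinal.isRegular_aleph_add_one.{u} 3
  rwa [show (3 + 1 : Ordinal.{u}) = 4 by norm_num] at this

theorem a23 : (aleph 3 : Cardinal.{u}) = Order.succ (aleph 2) := by
  rw [Cardinal.succ_aleph, show (2 + 1 : Ordinal.{u}) = 3 by norm_num]

theorem a34 : (aleph 4 : Cardinal.{u}) = Order.succ (aleph 3) := by
  rw [Cardinal.succ_aleph, show (3 + 1 : Ordinal.{u}) = 4 by norm_num]

theorem a12 : (aleph 2 : Cardinal.{u}) = Order.succ (aleph 1) := by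
  rw [Cardinal.succ_aleph, show (1 + 1 : Ordinal.{u}) = 2 by norm_num]

theorem w3_cof : ℵ₀ < ((aleph 3).ord : Ordinal.{u}).cof := by
  rw [reg3.cof_ord, a23, Order.lt_succ_iff]
  exact Cardinal.aleph0_le_aleph _

theorem aleph0_lt_a3 : ℵ₀ < (aleph 3 : Cardinal.{u}) := by
  rw [a23, Order.lt_succ_iff]
  exact Cardinal.aleph0_le_aleph _

theorem mk_Iio1 : #(Iio ((aleph 1).ord : Ordinal.{u})) = aleph 1 := by
  rw [Cardinal.mk_Iio_ordinal, Cardinal.card_ord, Cardinal.lift_aleph]; simp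

theorem mk_Iio3 : #(Iio ((aleph 3).ord : Ordinal.{u})) = aleph 3 := by
  rw [Cardinal.mk_Iio_ordinal, Cardinal.card_ord, Cardinal.lift_aleph]; simp

theorem lift_a3 : Cardinal.lift.{v} (aleph 3 : Cardinal.{u}) = aleph 3 := by
  rw [Cardinal.lift_aleph]; simp

theorem lift_a2 : Cardinal.lift.{v} (aleph 2 : Cardinal.{u}) = aleph 2 := by
  rw [Cardinal.lift_aleph]; simp

theorem step2 (h2 : (2 : Cardinal.{u+1}) ^ (aleph 1 : Cardinal.{u+1}) = aleph 2)
    {A : Set Ordinal.{u}} {e} (E : Enu A e) (hA : ∀ g ∈ A, g < (aleph 3).ord)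
    (hAstat : IsStatIn A (aleph 3).ord)
    (F : Ordinal.{u} → Ordinal.{u}) (hF : ∀ a < (aleph 3).ord, a.cof = ℵ₀ → F a < a) :
    ∃ p : Iio ((aleph 3).ord : Ordinal.{u}) ×
        (Iio ((aleph 1).ord : Ordinal.{u}) → Iio ((aleph 3).ord : Ordinal.{u})),
      IsStatIn {g | g ∈ A ∧ IsStatIn {n | F (e g n) < p.1.1} (aleph 1).ord ∧
        ∀ n, min (F (e g n.1)) p.1.1 = (p.2 n).1} (aleph 3).ord := by
  by_contra hcon
  push Not at hcon
  have hl3 : Lim ((aleph 3).ord : Ordinal.{u}) := lim_of_aleph0_le w3_cof.le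
  have h1 : ∀ d, ∀ x : (Iio ((aleph 1).ord : Ordinal.{u}) → Iio (d+1)),
      ∃ D, d < (aleph 3).ord → IsClubIn D (aleph 3).ord ∧ ∀ g ∈ D, g ∈ A →
        IsStatIn {n | F (e g n) < d} (aleph 1).ord →
        ¬ ∀ n : Iio ((aleph 1).ord : Ordinal.{u}), min (F (e g n.1)) d = (x n).1 := by
    intro d x
    by_cases hd : d < (aleph 3).ord
    · have := hcon ⟨⟨d, hd⟩, fun n => ⟨(x n).1, lt_trans (x n).2 (hl3.2 d hd)⟩⟩
      simp only [IsStatIn, not_forall] at this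
      obtain ⟨D, hD, hne⟩ := this
      refine ⟨D, fun _ => ⟨hD, fun g hg hgA hst hall => hne ⟨g, ⟨hgA, ?_, hall⟩, hg⟩⟩⟩
      intro D' hD'
      exact hst D' hD'
    · exact ⟨∅, fun h => absurd h hd⟩
  choose D hD using h1
  have hdiag := club_diag reg3 aleph0_lt_a3
    (fun d => (Iio ((aleph 1).ord : Ordinal.{u}) → Iio (d+1))) (by
      intro d hd
      rw [← Cardinal.power_def, mk_Iio1, Cardinal.mk_Iio_ordinal, lift_a3]
      have h5 : Cardinal.lift.{u+1} (d+1).card ≤ aleph 2 := by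
        rw [← lift_a2.{u, u+1}, Cardinal.lift_le, ← Order.lt_succ_iff, ← a23]
        exact Cardinal.lt_ord.1 (hl3.2 d hd)
      refine lt_of_le_of_lt (Cardinal.power_le_power_right h5) ?_
      rw [← h2, ← Cardinal.power_mul, Cardinal.mul_eq_self (Cardinal.aleph0_le_aleph 1), h2, a23]
      exact Order.lt_succ _) D (fun d hd x => (hD d x hd).1)
  obtain ⟨g, hgA, hg3, hgl, hgD⟩ := hAstat _ hdiag
  obtain ⟨d, hdg, hst⟩ := E.fodor hgA F (fun a ha hc => hF a (ha.trans hg3) hc)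
  have hd3 := hdg.trans hg3
  refine (hD d (fun n => ⟨min (F (e g n.1)) d, ?_⟩) hd3).2 g (hgD d hdg _) hgA hst (fun n => rfl)
  exact lt_of_le_of_lt (min_le_right _ _) (lt_add_one d)

theorem core (h2 : (2 : Cardinal.{u+1}) ^ (aleph 1 : Cardinal.{u+1}) = aleph 2)
    (h3 : (2 : Cardinal.{u+1}) ^ (aleph 2 : Cardinal.{u+1}) = aleph 3)
    {A : Set Ordinal.{u}} {e} (E : Enu A e) (hA : ∀ g ∈ A, g < (aleph 3).ord)
    (hcof : ∀ g ∈ A, g.cof = aleph 1)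
    (hAstat : IsStatIn A (aleph 3).ord) (ι : Type (u+1)) (hι : #ι = aleph 4)
    (F : ι → Ordinal.{u} → Ordinal.{u})
    (hF : ∀ i, ∀ a < (aleph 3).ord, a.cof = ℵ₀ → F i a < a)
    (hne : ∀ i j, i ≠ j → ∃ D, IsClubIn D (aleph 3).ord ∧ ∀ a ∈ D, a.cof = ℵ₀ → F i a ≠ F j a) :
    ∃ I : Set ι, aleph 4 ≤ #I ∧ ∃ S : ι → Set Ordinal.{u},
      (∀ i ∈ I, S i ⊆ {α | α < (aleph 3).ord ∧ α.cof = ℵ₀} ∧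
        IsStatIn (S i) (aleph 3).ord ∧ IsStatIn (Tr3 (S i) ∩ A) (aleph 3).ord) ∧
      ∀ i ∈ I, ∀ j ∈ I, i ≠ j →
        ¬ IsStatIn ((Tr3 (S i) ∩ A) ∩ (Tr3 (S j) ∩ A)) (aleph 3).ord := by
  have hlim : ∀ g ∈ A, Lim g := fun g hg => lim_of_aleph0_le (by
    rw [hcof g hg]; exact Cardinal.aleph0_le_aleph 1)
  choose p hp using fun i => step2 h2 E hA hAstat (F i) (hF i)
  obtain ⟨⟨d, x⟩, hdx⟩ := Cardinal.infinite_pigeonhole_card p (aleph 4) hι.ge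
    (Cardinal.aleph0_le_aleph _) (by
      rw [reg4.cof_ord, a34, Order.lt_succ_iff, ← Cardinal.mul_def, ← Cardinal.power_def, mk_Iio1, mk_Iio3]
      nth_rewrite 2 [← h3]
      rw [← Cardinal.power_mul, Cardinal.mul_eq_left (Cardinal.aleph0_le_aleph _) _ (Cardinal.aleph_pos _).ne', h3,
        Cardinal.mul_eq_self (Cardinal.aleph0_le_aleph _)]
      rw [a12]; exact Order.le_succ _)
  -- the witnesses
  let S : ι → Set Ordinal.{u} := fun i => {a | ∃ g ∈ A, ∃ n < (aleph 1).ord, Lim n ∧ a = e g n ∧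
    ∀ m : Iio ((aleph 1).ord : Ordinal.{u}), m.1 ≤ n → (x m).1 < d.1 → F i (e g m.1) = (x m).1}
  have hsub : ∀ i, S i ⊆ {α | α < (aleph 3).ord ∧ α.cof = ℵ₀} := by
    rintro i a ⟨g, hg, n, hn, hl, rfl, _⟩
    exact ⟨(E.lt g hg n hn).trans (hA g hg), E.cof hg hn hl⟩
  have htr : ∀ i ∈ p ⁻¹' {(d, x)}, IsStatIn (Tr3 (S i) ∩ A) (aleph 3).ord := by
    intro i hi D hD
    obtain ⟨g, ⟨hgA, hst, hall⟩, hgD⟩ := hp i D hD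
    have hi' : p i = (d, x) := hi
    rw [hi'] at hst hall
    refine ⟨g, ⟨⟨hA g hgA, ?_⟩, hgA⟩, hgD⟩
    intro K hK
    obtain ⟨n, ⟨hn, hl, hnK⟩, _⟩ := (E.pull hgA (hlim g hgA) hK).2.1 0 w1_lim.1
    refine ⟨e g n, ⟨⟨g, hgA, n, hn, hl, rfl, ?_⟩, E.lt g hgA n hn⟩, hnK⟩
    intro m _ hm
    have h4 := hall m
    rw [← h4] at hm ⊢
    rcases min_lt_iff.1 hm with h | h
    · exact (min_eq_left h.le).symm
    · exact absurd h (lt_irrefl _)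
  refine ⟨p ⁻¹' {(d, x)}, hdx, S, fun i hi => ⟨hsub i, ?_, htr i hi⟩, ?_⟩
  · intro D hD
    obtain ⟨g, ⟨⟨hg3, hst⟩, hgA⟩, _, hgl, hgD⟩ := htr i hi _ (club_lim w3_cof hD)
    obtain ⟨a, ha, haD⟩ := hst (D ∩ Iio g) ⟨fun a ha => ha.2, fun b hb => by
      obtain ⟨c, hc, hbc, hcg⟩ := hgD b hb
      exact ⟨c, ⟨hc, hcg⟩, hbc.le⟩, fun a ha h0 h => by
      refine ⟨hD.2.2 a (ha.trans hg3) h0 ?_, ha⟩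
      intro b hb
      obtain ⟨c, hc, hbc⟩ := h b hb
      exact ⟨c, hc.1, hbc⟩⟩
    exact ⟨a, ha.1, haD.1⟩
  · intro i hi j hj hij hstat
    obtain ⟨D, hD, hDne⟩ := hne i j hij
    -- `T` is stationary
    have hT : IsStatIn {n | ∃ h : n < (aleph 1).ord, (x ⟨n, h⟩).1 < d.1} (aleph 1).ord := by
      obtain ⟨g, ⟨hgA, hst, hall⟩, _⟩ := hp i _ (club_lim w3_cof hD)
      have hi' : p i = (d, x) := hi
      rw [hi'] at hst hall
      intro K hK
      obtain ⟨n, hn, hnK⟩ := hst K hK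
      refine ⟨n, ⟨hK.1 hnK, ?_⟩, hnK⟩
      have h4 := hall ⟨n, hK.1 hnK⟩
      rw [← h4]
      exact lt_of_le_of_lt (min_le_left _ _) hn
    obtain ⟨g, ⟨⟨⟨hg3, hsti⟩, hgA⟩, ⟨_, hstj⟩, _⟩, _, hgl, hgD⟩ := hstat _ (club_lim w3_cof hD)
    have hDg : IsClubIn (D ∩ Iio g) g := ⟨fun a ha => ha.2, fun b hb => by
      obtain ⟨c, hc, hbc, hcg⟩ := hgD b hb
      exact ⟨c, ⟨hc, hcg⟩, hbc.le⟩, fun a ha h0 h => by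
      refine ⟨hD.2.2 a (ha.trans hg3) h0 ?_, ha⟩
      intro b hb
      obtain ⟨c, hc, hbc⟩ := h b hb
      exact ⟨c, hc.1, hbc⟩⟩
    have hfull : ∀ k, IsStatIn (S k ∩ Iio g) g → ∀ m : Iio ((aleph 1).ord : Ordinal.{u}),
        (x m).1 < d.1 → F k (e g m.1) = (x m).1 := by
      intro k hk m hm
      have hCl := E.club g hgA
      have hm2 := E.lt g hgA m.1 m.2
      obtain ⟨a, ⟨⟨g', hg'A, n', hn', hl', rfl, hall⟩, _⟩, ⟨n, hn, hnn⟩, hlt⟩ :=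
        hk ((e g '' Iio (aleph 1).ord) ∩ {y | e g m.1 < y}) ⟨fun a ha => hCl.1 ha.1, fun b hb => by
          obtain ⟨c, hc, hbc, _⟩ := club_gt (hlim g hgA) hCl (max_lt hb hm2)
          exact ⟨c, ⟨hc, (le_max_right _ _).trans_lt hbc⟩, ((le_max_left _ _).trans_lt hbc).le⟩,
          fun a ha h0 h => by
          refine ⟨hCl.2.2 a ha h0 ?_, ?_⟩
          · intro b hb
            obtain ⟨c, hc, hbc⟩ := h b hb
            exact ⟨c, hc.1, hbc⟩
          · obtain ⟨c, hc, _, hca⟩ := h 0 h0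
            exact lt_trans hc.2 hca⟩
      obtain ⟨rfl, hag⟩ := E.coh g hgA g' hg'A n hn n' hn' hnn
      have hmn : m.1 ≤ n := by
        by_contra hc
        have h6 := E.mono g hgA m.1 m.2 n (not_le.1 hc)
        rw [hnn] at h6
        exact lt_asymm h6 hlt
      rw [hag m.1 hmn]
      exact hall m hmn hm
    obtain ⟨n, ⟨hn, hnx⟩, _, hl, hnD⟩ := hT _ (E.pull hgA (hlim g hgA) hDg)
    apply hDne _ hnD.1 (E.cof hgA hn hl)
    rw [hfull i hsti ⟨n, hn⟩ hnx, hfull j hstj ⟨n, hn⟩ hnx]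

theorem gch {n m : ℕ} (hm : m = n + 1) (hGCH : (2 : Cardinal.{u}) ^ (aleph n : Cardinal.{u}) = Order.succ (aleph n)) :
    (2 : Cardinal.{v}) ^ (aleph n : Cardinal.{v}) = aleph m := by
  subst hm
  have h1 := congrArg Cardinal.lift.{v} hGCH
  rw [Cardinal.lift_two_power, Cardinal.succ_aleph, Cardinal.lift_aleph, Cardinal.lift_aleph] at h1
  apply Cardinal.lift_injective.{u}
  rw [Cardinal.lift_two_power, Cardinal.lift_aleph, Cardinal.lift_aleph]
  simpa using h1

theorem transfer (n : ℕ) (a : Ordinal.{u}) (ha : a < (aleph n).ord) :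
    ∃ b : Ordinal.{v}, Ordinal.lift.{v} a = Ordinal.lift.{u} b ∧ b < (aleph n).ord := by
  have h1 : Ordinal.lift.{v} a < Ordinal.lift.{u} (((aleph n).ord : Ordinal.{v})) := by
    have h2 := Ordinal.lift_lt.{v}.2 ha
    rw [Cardinal.lift_ord, Cardinal.lift_aleph] at h2 ⊢
    simpa using h2
  obtain ⟨b, hb⟩ := Ordinal.mem_range_lift_of_le h1.le
  rw [← hb, Ordinal.lift_lt] at h1
  exact ⟨b, hb.symm, h1⟩

theorem mk_Iio4 : #(Iio ((aleph 4).ord : Ordinal.{u})) = aleph 4 := by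
  rw [Cardinal.mk_Iio_ordinal, Cardinal.card_ord, Cardinal.lift_aleph]; simp

theorem emb {α : Type u} {β : Type v} (h : #α = aleph 4) (h' : aleph 4 ≤ #β) :
    Nonempty (α ↪ β) := by
  rw [← Cardinal.lift_mk_le', h]
  have := Cardinal.lift_le.{u}.2 h'
  rw [Cardinal.lift_aleph] at this ⊢
  simpa using this

universe u1 u2 u3 u4 u5

theorem transfer3 : ∃ T : Ordinal.{u} → Ordinal.{v}, ∀ a < (aleph 3).ord,
    Ordinal.lift.{v} a = Ordinal.lift.{u} (T a) ∧ T a < (aleph 3).ord := by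
  choose! T hT using fun (a : Ordinal.{u}) (ha : a < (aleph 3).ord) =>
    transfer.{u, v} 3 a (by simpa using ha)
  exact ⟨T, fun a ha => by simpa using hT a ha⟩

theorem main
    (hGCH : ∀ c : Cardinal.{u1}, Cardinal.aleph0 ≤ c → (2 : Cardinal) ^ c = Order.succ c)
    (A : Set Ordinal.{u2})
    (hA : A ⊆ {γ | γ < (Cardinal.aleph 3).ord ∧ Ordinal.cof γ = Cardinal.aleph 1})
    (hAstat : IsStatIn A (Cardinal.aleph 3).ord)
    (C : Ordinal → Set Ordinal)
    (hclub : ∀ γ ∈ A, IsClubIn (C γ) γ)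
    (hotp : ∀ γ ∈ A, otp (C γ) = (Cardinal.aleph 1).ord)
    (hcoh : ∀ γ₁ ∈ A, ∀ γ₂ ∈ A, ∀ α, α ∈ C γ₁ ∩ C γ₂ →
      C γ₁ ∩ Set.Iio α = C γ₂ ∩ Set.Iio α)
    (f : Ordinal.{u3} → Ordinal.{u4} → Ordinal.{u4})
    (hreg : ∀ i < (Cardinal.aleph 4).ord, ∀ α, α < (Cardinal.aleph 3).ord →
      Ordinal.cof α ≤ Cardinal.aleph 1 → 0 < α → f i α < α)
    (halmost : ∀ i < (Cardinal.aleph 4).ord, ∀ j < (Cardinal.aleph 4).ord, i ≠ j →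
      ¬ IsStatIn {α | α < (Cardinal.aleph 3).ord ∧ f i α = f j α}
        (Cardinal.aleph 3).ord) :
    ∃ S : Ordinal.{u5} → Set Ordinal.{u2},
      (∀ i < (Cardinal.aleph 4).ord,
        S i ⊆ {α | α < (Cardinal.aleph 3).ord ∧ Ordinal.cof α = Cardinal.aleph0} ∧
        IsStatIn (S i) (Cardinal.aleph 3).ord ∧
        IsStatIn (Tr3 (S i) ∩ A) (Cardinal.aleph 3).ord) ∧
      ∀ i < (Cardinal.aleph 4).ord, ∀ j < (Cardinal.aleph 4).ord, i ≠ j →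
        ¬ IsStatIn ((Tr3 (S i) ∩ A) ∩ (Tr3 (S j) ∩ A)) (Cardinal.aleph 3).ord := by
  classical
  have h2 : (2 : Cardinal.{u2+1}) ^ (aleph 1 : Cardinal.{u2+1}) = aleph 2 := by
    simpa using gch.{u1, u2+1} (n := 1) (m := 2) rfl (hGCH _ (Cardinal.aleph0_le_aleph _))
  have h3 : (2 : Cardinal.{u2+1}) ^ (aleph 2 : Cardinal.{u2+1}) = aleph 3 := by
    simpa using gch.{u1, u2+1} (n := 2) (m := 3) rfl (hGCH _ (Cardinal.aleph0_le_aleph _))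
  obtain ⟨e, E⟩ := exists_enu (fun g hg => (hA hg).2) C hclub hotp hcoh
  obtain ⟨φ⟩ := emb mk_Iio4.{u2} mk_Iio4.{u3}.ge
  obtain ⟨T, hT⟩ := transfer3.{u2, u4}
  obtain ⟨U, hU⟩ := transfer3.{u4, u2}
  have hTlt : ∀ a < (aleph 3).ord, ∀ b < (aleph 3).ord, a < b → T a < T b := by
    intro a ha b hb hab
    have := Ordinal.lift_lt.{u4}.2 hab
    rwa [(hT a ha).1, (hT b hb).1, Ordinal.lift_lt] at this
  have hTU : ∀ b < (aleph 3).ord, T (U b) = b := by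
    intro b hb
    have h := (hT (U b) (hU b hb).2).1
    rw [← (hU b hb).1, Ordinal.lift_inj] at h
    exact h.symm
  have hUT : ∀ b < (aleph 3).ord, U (T b) = b := by
    intro b hb
    have h := (hU (T b) (hT b hb).2).1
    rw [← (hT b hb).1, Ordinal.lift_inj] at h
    exact h.symm
  have hUlt : ∀ a < (aleph 3).ord, ∀ b < (aleph 3).ord, a < b → U a < U b := by
    intro a ha b hb hab
    have := Ordinal.lift_lt.{u2}.2 hab
    rwa [(hU a ha).1, (hU b hb).1, Ordinal.lift_lt] at this
  have hfT : ∀ i < (aleph 4).ord, ∀ a < (aleph 3).ord, a.cof = ℵ₀ → f i (T a) < T a := by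
    intro i hi a ha hc
    have hc' : (T a).cof = ℵ₀ := by
      have h := congrArg Ordinal.cof (hT a ha).1
      rw [← Ordinal.lift_cof, ← Ordinal.lift_cof, hc, Cardinal.lift_aleph0] at h
      exact (Cardinal.lift_eq_aleph0.1 h.symm)
    refine hreg i hi (T a) (hT a ha).2 ?_ ?_
    · rw [hc']; exact Cardinal.aleph0_le_aleph 1
    · exact (lim_of_aleph0_le hc'.ge).1
  obtain ⟨I, hI, S, hS1, hS2⟩ := core h2 h3 E (fun g hg => (hA hg).1) (fun g hg => (hA hg).2) hAstat
    (Iio ((aleph 4).ord : Ordinal.{u2})) mk_Iio4 (fun i a => U (f (φ i).1 (T a)))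
    (by
      intro i a ha hc
      have h1 := hfT (φ i).1 (φ i).2 a ha hc
      have h3 := hUlt _ (h1.trans (hT a ha).2) _ (hT a ha).2 h1
      rwa [hUT a ha] at h3)
    (by
      intro i j hij
      have h := halmost (φ i).1 (φ i).2 (φ j).1 (φ j).2
        (fun h => hij (φ.injective (Subtype.ext h)))
      simp only [IsStatIn, not_forall] at h
      obtain ⟨D, hD, hne⟩ := h
      refine ⟨{a | a < (aleph 3).ord ∧ T a ∈ D}, ⟨fun a ha => ha.1, ?_, ?_⟩, ?_⟩
      · intro b hb
        obtain ⟨c, hc, hbc⟩ := hD.2.1 (T b) (hT b hb).2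
        have hc3 : c < (aleph 3).ord := hD.1 hc
        refine ⟨U c, ⟨(hU c hc3).2, ?_⟩, ?_⟩
        · rw [hTU c hc3]; exact hc
        · by_contra hlt
          have := hTlt _ (hU c hc3).2 _ hb (not_le.1 hlt)
          rw [hTU c hc3] at this
          exact not_lt.2 hbc this
      · intro a ha h0 h
        refine ⟨ha, hD.2.2 (T a) (hT a ha).2 ?_ ?_⟩
        · exact lt_of_le_of_lt zero_le (hTlt 0 (h0.trans ha) a ha h0)
        · intro b hb
          have hb3 := hb.trans (hT a ha).2
          have hUb := hUlt b hb3 _ (hT a ha).2 hb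
          rw [hUT a ha] at hUb
          obtain ⟨c, hc, hbc, hca⟩ := h _ hUb
          have h7 := hTlt _ (hU b hb3).2 _ hc.1 hbc
          rw [hTU b hb3] at h7
          exact ⟨T c, hc.2, h7, hTlt _ hc.1 _ ha hca⟩
      · rintro a ⟨ha, haD⟩ hc heq
        have h8 := congrArg T heq
        rw [hTU _ ((hfT _ (φ i).2 a ha hc).trans (hT a ha).2),
          hTU _ ((hfT _ (φ j).2 a ha hc).trans (hT a ha).2)] at h8
        exact hne ⟨T a, ⟨(hT a ha).2, h8⟩, haD⟩)
  obtain ⟨ψ⟩ := emb mk_Iio4.{u5} hI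
  refine ⟨fun k => if h : k < (aleph 4).ord then S (ψ ⟨k, h⟩).1 else ∅, ?_, ?_⟩
  · intro i hi
    simp only [hi, dite_true]
    exact hS1 _ (ψ ⟨i, hi⟩).2
  · intro i hi j hj hij
    simp only [hi, hj, dite_true]
    refine hS2 _ (ψ ⟨i, hi⟩).2 _ (ψ ⟨j, hj⟩).2 ?_
    intro h
    have := ψ.injective (Subtype.ext h)
    exact hij (congrArg Subtype.val this)

end SQ

/-- GCH: If `A ⊆ S³₁` is stationary with a square sequence and
there are regressive functions `f i` (`i < ω₄`) on `{α < ω₃ : cf α ≤ ω₁}` with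
`{α : f i α = f j α}` nonstationary for `i ≠ j`, then there are stationary sets
`S i ⊆ {α < ω₃ : cf α = ω}` (`i < ω₄`) such that the sets `Tr(S i) ∩ A` are
stationary and pairwise almost disjoint. -/
theorem stmt17
    (hGCH : ∀ c : Cardinal, Cardinal.aleph0 ≤ c → (2 : Cardinal) ^ c = Order.succ c)
    (A : Set Ordinal)
    (hA : A ⊆ {γ | γ < (Cardinal.aleph 3).ord ∧ Ordinal.cof γ = Cardinal.aleph 1})
    (hAstat : IsStatIn A (Cardinal.aleph 3).ord)
    (C : Ordinal → Set Ordinal)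
    (hclub : ∀ γ ∈ A, IsClubIn (C γ) γ)
    (hotp : ∀ γ ∈ A, otp (C γ) = (Cardinal.aleph 1).ord)
    (hcoh : ∀ γ₁ ∈ A, ∀ γ₂ ∈ A, ∀ α, α ∈ C γ₁ ∩ C γ₂ →
      C γ₁ ∩ Set.Iio α = C γ₂ ∩ Set.Iio α)
    (f : Ordinal → Ordinal → Ordinal)
    (hreg : ∀ i < (Cardinal.aleph 4).ord, ∀ α, α < (Cardinal.aleph 3).ord →
      Ordinal.cof α ≤ Cardinal.aleph 1 → 0 < α → f i α < α)
    (halmost : ∀ i < (Cardinal.aleph 4).ord, ∀ j < (Cardinal.aleph 4).ord, i ≠ j →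
      ¬ IsStatIn {α | α < (Cardinal.aleph 3).ord ∧ f i α = f j α}
        (Cardinal.aleph 3).ord) :
    ∃ S : Ordinal → Set Ordinal,
      (∀ i < (Cardinal.aleph 4).ord,
        S i ⊆ {α | α < (Cardinal.aleph 3).ord ∧ Ordinal.cof α = Cardinal.aleph0} ∧
        IsStatIn (S i) (Cardinal.aleph 3).ord ∧
        IsStatIn (Tr3 (S i) ∩ A) (Cardinal.aleph 3).ord) ∧
      ∀ i < (Cardinal.aleph 4).ord, ∀ j < (Cardinal.aleph 4).ord, i ≠ j →
        ¬ IsStatIn ((Tr3 (S i) ∩ A) ∩ (Tr3 (S j) ∩ A)) (Cardinal.aleph 3).ord := by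
  exact SQ.main hGCH A hA hAstat C hclub hotp hcoh f hreg halmost
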